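/- arXiv:1001.1026 — 2 statements merged into one kernel-verified Lean document; each statement's English description precedes it below -/
import Mathlib

section
/- Let m ≥ 2 be an integer and λ ≥ 0 a real number. For every real number p with 0 ≤ p ≤ 1/((m-1)·(λm − λ + 1)), one has p·(1-p)^{m-1} ≥ λ·(∑_{i=2}^{m} C(m,i)·p^i·(1-p)^{m-i}), where C(m,i) denotes the binomial coefficient m choose i. -/
/-- The binomial tail from two successes on is the complement of the first two terms. -/
theorem sum_Icc_two_binomial (n : ℕ) (p : ℝ) :
    ∑ i ∈ Finset.Icc 2 (n + 1), ((n + 1).choose i : ℝ) * p ^ i * (1 - p) ^ (n + 1 - i)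
      = 1 - (1 - p) ^ n * (1 + n * p) := by
  have htotal : ∑ i ∈ Finset.range (n + 1 + 1),
      ((n + 1).choose i : ℝ) * p ^ i * (1 - p) ^ (n + 1 - i) = 1 := by
    have h := add_pow p (1 - p) (n + 1)
    rw [add_sub_cancel, one_pow] at h
    exact (Finset.sum_congr rfl fun i _ => by ring).trans h.symm
  have hsplit := Finset.sum_range_add_sum_Ico
    (fun i => ((n + 1).choose i : ℝ) * p ^ i * (1 - p) ^ (n + 1 - i))
    (show 2 ≤ n + 1 + 1 by omega)
  rw [htotal] at hsplit
  have hIcc : Finset.Icc 2 (n + 1) = Finset.Ico 2 (n + 1 + 1) := by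
    ext i
    simp only [Finset.mem_Icc, Finset.mem_Ico]
    omega
  rw [hIcc]
  simp only [Finset.sum_range_succ, Finset.sum_range_zero, Nat.choose_zero_right,
    Nat.choose_one_right, Nat.add_sub_cancel, Nat.sub_zero] at hsplit
  push_cast at hsplit
  linear_combination hsplit

/-- Core inequality of Proposition 1: for `m ≥ 2`, `λ ≥ 0` and
`0 ≤ p ≤ 1/((m-1)(λ m - λ + 1))`,
`p (1-p)^(m-1) ≥ λ ∑_{i=2}^m C(m,i) p^i (1-p)^(m-i)`. -/
theorem single_edge_dominates_of_le_threshold (m : ℕ) (hm : 2 ≤ m)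
    (lam : ℝ) (hlam : 0 ≤ lam) (p : ℝ) (hp0 : 0 ≤ p)
    (hp1 : p ≤ 1 / (((m : ℝ) - 1) * (lam * m - lam + 1))) :
    p * (1 - p) ^ (m - 1)
      ≥ lam * ∑ i ∈ Finset.Icc 2 m, (m.choose i : ℝ) * p ^ i * (1 - p) ^ (m - i) := by
  obtain ⟨n, rfl⟩ : ∃ n, m = n + 1 := ⟨m - 1, by omega⟩
  rw [sum_Icc_two_binomial, Nat.add_sub_cancel]
  have hn : (1 : ℝ) ≤ n := by exact_mod_cast (show 1 ≤ n by omega)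
  have hpos : 0 < (n : ℝ) * (lam * n + 1) := by positivity
  have hden : (((n + 1 : ℕ) : ℝ) - 1) * (lam * ((n + 1 : ℕ) : ℝ) - lam + 1)
      = n * (lam * n + 1) := by
    push_cast
    ring
  rw [hden, le_div_iff₀ hpos] at hp1
  have hple : p ≤ 1 := by
    have : 0 ≤ lam * n * n := by positivity
    nlinarith
  have hbern : 1 - n * p ≤ (1 - p) ^ n := by
    have h := one_add_mul_le_pow (show (-2 : ℝ) ≤ -p by linarith) n
    rw [← sub_eq_add_neg] at h
    linarith
  have hfac : 0 ≤ p + lam + lam * n * p := by positivity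
  have hmul := mul_le_mul_of_nonneg_right hbern hfac
  have hthr := mul_nonneg hp0 (sub_nonneg.2 hp1)
  linarith
end

section
/- Let m ≥ 2 be an integer, λ ≥ 0 a real number, and (a_i)_{i=1}^{m} a sequence of natural numbers with a_1 ≥ 1 and a_i ≤ C(m,i) for all 2 ≤ i ≤ m, where C(m,i) denotes the binomial coefficient m choose i. Then for every real number p with 0 ≤ p ≤ 1/((m-1)·(λm − λ + 1)), one has a_1·p·(1-p)^{m-1} ≥ λ·(∑_{i=2}^{m} a_i·p^i·(1-p)^{m-i}). -/
/-- The binomial weights of index at least two are the total mass minus the first two weights. -/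
lemma sum_Icc_two_choose_mul_pow (n : ℕ) (p : ℝ) :
    ∑ i ∈ Finset.Icc 2 (n + 1), ((n + 1).choose i : ℝ) * p ^ i * (1 - p) ^ (n + 1 - i)
      = 1 - (1 - p) ^ (n + 1) - (n + 1) * p * (1 - p) ^ n := by
  have hsum := add_pow p (1 - p) (n + 1)
  rw [add_sub_cancel, one_pow, Finset.range_eq_Ico,
    Finset.sum_eq_sum_Ico_succ_bot (by omega), Finset.sum_eq_sum_Ico_succ_bot (by omega)] at hsum
  have hIcc : Finset.Icc 2 (n + 1) = Finset.Ico (0 + 1 + 1) (n + 1 + 1) := by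
    ext i
    simp only [Finset.mem_Icc, Finset.mem_Ico]
    omega
  have hcomm : ∀ i ∈ Finset.Ico (0 + 1 + 1) (n + 1 + 1),
      ((n + 1).choose i : ℝ) * p ^ i * (1 - p) ^ (n + 1 - i)
        = p ^ i * (1 - p) ^ (n + 1 - i) * ((n + 1).choose i : ℝ) := fun i _ => by ring
  rw [hIcc, Finset.sum_congr rfl hcomm]
  simp only [pow_zero, one_mul, tsub_zero, Nat.choose_zero_right, Nat.cast_one, mul_one,
    zero_add, pow_one, add_tsub_cancel_right, Nat.choose_one_right, Nat.cast_add] at hsum ⊢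
  linarith

/-- The binomial weights of index at least two sum to at most `n p (1 - (1 - p) ^ n)`. -/
lemma sum_Icc_two_choose_mul_pow_le (n : ℕ) {p : ℝ} (hp : p ≤ 1) :
    ∑ i ∈ Finset.Icc 2 (n + 1), ((n + 1).choose i : ℝ) * p ^ i * (1 - p) ^ (n + 1 - i)
      ≤ n * p * (1 - (1 - p) ^ n) := by
  have hbern := one_add_mul_le_pow (a := -p) (by linarith) n
  rw [← sub_eq_add_neg] at hbern
  rw [sum_Icc_two_choose_mul_pow, pow_succ]
  linarith


/-- Proposition 1: for `m ≥ 2`, `λ ≥ 0`, natural numbers `a i` with `a 1 ≥ 1` and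
`a i ≤ C(m,i)` for `2 ≤ i ≤ m`, and `0 ≤ p ≤ 1/((m-1)(λ m - λ + 1))`,
`a 1 · p (1-p)^(m-1) ≥ λ ∑_{i=2}^m a i · p^i (1-p)^(m-i)`. -/
theorem proposition_one (m : ℕ) (hm : 2 ≤ m) (lam : ℝ) (hlam : 0 ≤ lam)
    (a : ℕ → ℕ) (ha1 : 1 ≤ a 1) (ha : ∀ i, 2 ≤ i → i ≤ m → a i ≤ m.choose i)
    (p : ℝ) (hp0 : 0 ≤ p)
    (hp1 : p ≤ 1 / (((m : ℝ) - 1) * (lam * m - lam + 1))) :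
    (a 1 : ℝ) * p * (1 - p) ^ (m - 1)
      ≥ lam * ∑ i ∈ Finset.Icc 2 m, (a i : ℝ) * p ^ i * (1 - p) ^ (m - i) := by
  obtain ⟨n, rfl⟩ : ∃ n, m = n + 1 := ⟨m - 1, by omega⟩
  have hn : (1 : ℝ) ≤ n := by exact_mod_cast Nat.le_of_succ_le_succ hm
  have hD : ((n + 1 : ℕ) : ℝ) - 1 = n := by push_cast; ring
  have hL : lam * ((n + 1 : ℕ) : ℝ) - lam + 1 = lam * n + 1 := by push_cast; ring
  have hln : 0 ≤ lam * n := by positivity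
  rw [hD, hL, le_div_iff₀ (by positivity)] at hp1
  have hnp : n * p ≤ 1 := by nlinarith [mul_nonneg hln (mul_nonneg (by linarith : (0 : ℝ) ≤ n) hp0)]
  have hp_le : p ≤ 1 := by nlinarith
  have hq : 0 ≤ 1 - p := by linarith
  have hbern := one_add_mul_le_pow (a := -p) (by linarith) n
  rw [← sub_eq_add_neg] at hbern
  have hkey : lam * n * (1 - (1 - p) ^ n) ≤ (1 - p) ^ n := by nlinarith
  rw [add_tsub_cancel_right, ge_iff_le]
  calc lam * ∑ i ∈ Finset.Icc 2 (n + 1), (a i : ℝ) * p ^ i * (1 - p) ^ (n + 1 - i)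
      ≤ lam * ∑ i ∈ Finset.Icc 2 (n + 1),
          ((n + 1).choose i : ℝ) * p ^ i * (1 - p) ^ (n + 1 - i) := by
        gcongr with i hi
        rw [Finset.mem_Icc] at hi
        exact ha i hi.1 hi.2
    _ ≤ lam * (n * p * (1 - (1 - p) ^ n)) := by
        gcongr
        exact sum_Icc_two_choose_mul_pow_le n hp_le
    _ = p * (lam * n * (1 - (1 - p) ^ n)) := by ring
    _ ≤ p * (1 - p) ^ n := by gcongr
    _ = 1 * p * (1 - p) ^ n := by ring
    _ ≤ (a 1 : ℝ) * p * (1 - p) ^ n := by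
        gcongr
        exact_mod_cast ha1
end
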